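/- Let a state of PIF satisfy RQ(l,m). If (l,m) ≠ (N−1,N), then the execution of any enabled action yields a state satisfying RQ(l+1,m) or RQ(l,m+1); if (l,m) = (N−1,N), then the only enabled action is reflect, and its execution yields a state satisfying RP(N−1). -/

import Mathlib

/-- Values of the state variable of a PIF process: idle, requesting, replying. -/
inductive PSt where
  | idle | rq | rp
deriving DecidableEq

/-- A PIF state on the chain of `N` processes is valid if the root (process 1)
never holds `rp` and the leaf (process `N`) never holds `rq`. -/
def PifValid (N : ℕ) (st : ℕ → PSt) : Prop := st 1 ≠ PSt.rp ∧ st N ≠ PSt.rq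

/-- One step of the PIF program on the chain of `N` processes: `st'` is
obtained from `st` by executing one enabled action (request, clear, forward,
back, stop, reflect or reset). -/
def pifStep (N : ℕ) (st st' : ℕ → PSt) : Prop :=
  -- request (root)
  (st 1 = PSt.idle ∧ st 2 = PSt.idle ∧ st' = Function.update st 1 PSt.rq) ∨
  -- clear (root)
  (st 1 = PSt.rq ∧ st 2 = PSt.rp ∧ st' = Function.update st 1 PSt.idle) ∨
  -- forward (intermediate)
  (∃ j, 2 ≤ j ∧ j ≤ N - 1 ∧ st (j - 1) = PSt.rq ∧ st j = PSt.idle ∧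
    st (j + 1) = PSt.idle ∧ st' = Function.update st j PSt.rq) ∨
  -- back (intermediate)
  (∃ j, 2 ≤ j ∧ j ≤ N - 1 ∧ st (j - 1) = PSt.rq ∧ st j = PSt.rq ∧
    st (j + 1) = PSt.rp ∧ st' = Function.update st j PSt.rp) ∨
  -- stop (intermediate)
  (∃ j, 2 ≤ j ∧ j ≤ N - 1 ∧ st (j - 1) = PSt.idle ∧ st j ≠ PSt.idle ∧
    st' = Function.update st j PSt.idle) ∨
  -- reflect (leaf)
  (st (N - 1) = PSt.rq ∧ st N = PSt.idle ∧ st' = Function.update st N PSt.rp) ∨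
  -- reset (leaf)
  (st (N - 1) = PSt.idle ∧ st N = PSt.rp ∧ st' = Function.update st N PSt.idle)

/-- `RP N k st`: the `k` leftmost processes are requesting and the rest are
replying (`1 ≤ k ≤ N - 1`). -/
def RP (N k : ℕ) (st : ℕ → PSt) : Prop :=
  1 ≤ k ∧ k ≤ N - 1 ∧
  (∀ j, 1 ≤ j → j ≤ k → st j = PSt.rq) ∧
  (∀ j, k < j → j ≤ N → st j = PSt.rp)

/-- `RQ N l m st`: the `l` leftmost processes are requesting, processes
`l+1 .. m` are idle, and the rest are replying (`0 ≤ l < m ≤ N`). -/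
def RQ (N l m : ℕ) (st : ℕ → PSt) : Prop :=
  l < m ∧ m ≤ N ∧
  (∀ j, 1 ≤ j → j ≤ l → st j = PSt.rq) ∧
  (∀ j, l < j → j ≤ m → st j = PSt.idle) ∧
  (∀ j, m < j → j ≤ N → st j = PSt.rp)

/-- `RP' N k st`: the `k` leftmost processes are requesting, process `k+1` is
replying, and no process beyond `k+1` is idle (`1 ≤ k ≤ N - 1`). -/
def RP' (N k : ℕ) (st : ℕ → PSt) : Prop :=
  1 ≤ k ∧ k ≤ N - 1 ∧
  (∀ j, 1 ≤ j → j ≤ k → st j = PSt.rq) ∧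
  st (k + 1) = PSt.rp ∧
  (∀ j, k + 1 < j → j ≤ N → st j ≠ PSt.idle)

/-- `RQ' N l m st`: the `l` leftmost processes are requesting, processes
`l+1 .. m` are idle, and the remaining processes are arbitrary
(`0 ≤ l < m ≤ N`). -/
def RQ' (N l m : ℕ) (st : ℕ → PSt) : Prop :=
  l < m ∧ m ≤ N ∧
  (∀ j, 1 ≤ j → j ≤ l → st j = PSt.rq) ∧
  (∀ j, l < j → j ≤ m → st j = PSt.idle)

/-- In an `RQ` state the value held by a process determines the block it lies in. -/
theorem RQ.classify {N l m : ℕ} {st : ℕ → PSt} (h : RQ N l m st) (j : ℕ) (h1 : 1 ≤ j)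
    (h2 : j ≤ N) :
    (st j = PSt.rq ↔ j ≤ l) ∧ (st j = PSt.idle ↔ l < j ∧ j ≤ m) ∧ (st j = PSt.rp ↔ m < j) := by
  obtain ⟨hlm, hmN, ha, hb, hc⟩ := h
  rcases Nat.lt_or_ge l j with hl | hl
  · rcases Nat.lt_or_ge m j with hm | hm
    · rw [hc j hm h2]; simp; omega
    · rw [hb j hl hm]; simp; omega
  · rw [ha j h1 hl]; simp; omega

/-- Advancing the requesting block. -/
theorem RQ.advance {N l m : ℕ} {st : ℕ → PSt} (h : RQ N l m st) (j : ℕ) (hj : j = l + 1)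
    (hm : j < m) : RQ N (l + 1) m (Function.update st j PSt.rq) := by
  obtain ⟨hlm, hmN, ha, hb, hc⟩ := h
  refine ⟨by omega, hmN, ?_, ?_, ?_⟩ <;> intro i h1 h2 <;> by_cases hi : i = j
  · simp [hi]
  · rw [Function.update_of_ne hi]; exact ha i h1 (by omega)
  · omega
  · rw [Function.update_of_ne hi]; exact hb i (by omega) h2
  · omega
  · rw [Function.update_of_ne hi]; exact hc i h1 h2

/-- Extending the idle block. -/
theorem RQ.extend {N l m : ℕ} {st : ℕ → PSt} (h : RQ N l m st) (j : ℕ) (hj : j = m + 1)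
    (hm : j ≤ N) : RQ N l (m + 1) (Function.update st j PSt.idle) := by
  obtain ⟨hlm, hmN, ha, hb, hc⟩ := h
  refine ⟨by omega, by omega, ?_, ?_, ?_⟩ <;> intro i h1 h2 <;> by_cases hi : i = j
  · omega
  · rw [Function.update_of_ne hi]; exact ha i h1 h2
  · simp [hi]
  · rw [Function.update_of_ne hi]; exact hb i h1 (by omega)
  · omega
  · rw [Function.update_of_ne hi]; exact hc i (by omega) h2

/-- From a state satisfying `RQ l m`: if `(l, m) ≠ (N-1, N)`, any enabled
action yields a state satisfying `RQ (l+1) m` or `RQ l (m+1)`; if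
`(l, m) = (N-1, N)`, the only enabled action is `reflect` and it yields a
state satisfying `RP (N-1)`. -/
theorem pif_rq_progress (N : ℕ) (hN : 3 ≤ N)
    (st : ℕ → PSt) (hv : PifValid N st)
    (l m : ℕ) (h : RQ N l m st) :
    (¬ (l = N - 1 ∧ m = N) →
      ∀ st', pifStep N st st' → RQ N (l + 1) m st' ∨ RQ N l (m + 1) st') ∧
    ((l = N - 1 ∧ m = N) →
      (∃ st', pifStep N st st') ∧
      ∀ st', pifStep N st st' →
        st' = Function.update st N PSt.rp ∧ RP N (N - 1) st') := by
  have hlm := h.1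
  have hmN := h.2.1
  have key : ∀ st', pifStep N st st' →
      (RQ N (l + 1) m st' ∨ RQ N l (m + 1) st') ∧ ¬ (l = N - 1 ∧ m = N) ∨
      (l = N - 1 ∧ m = N) ∧ st' = Function.update st N PSt.rp := by
    intro st' hs
    rcases hs with ⟨h1, h2, rfl⟩ | ⟨h1, h2, rfl⟩ | ⟨j, hj, hjN, h1, h2, h3, rfl⟩ |
      ⟨j, hj, hjN, h1, h2, h3, rfl⟩ | ⟨j, hj, hjN, h1, h2, rfl⟩ | ⟨h1, h2, rfl⟩ | ⟨h1, h2, rfl⟩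
    · rw [(h.classify 1 (by omega) (by omega)).2.1] at h1
      rw [(h.classify 2 (by omega) (by omega)).2.1] at h2
      exact Or.inl ⟨Or.inl (h.advance 1 (by omega) (by omega)), by omega⟩
    · rw [(h.classify 1 (by omega) (by omega)).1] at h1
      rw [(h.classify 2 (by omega) (by omega)).2.2] at h2
      omega
    · rw [(h.classify (j - 1) (by omega) (by omega)).1] at h1
      rw [(h.classify j (by omega) (by omega)).2.1] at h2
      rw [(h.classify (j + 1) (by omega) (by omega)).2.1] at h3
      exact Or.inl ⟨Or.inl (h.advance j (by omega) (by omega)), by omega⟩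
    · rw [(h.classify j (by omega) (by omega)).1] at h2
      rw [(h.classify (j + 1) (by omega) (by omega)).2.2] at h3
      omega
    · rw [(h.classify (j - 1) (by omega) (by omega)).2.1] at h1
      rw [Ne, (h.classify j (by omega) (by omega)).2.1] at h2
      exact Or.inl ⟨Or.inr (h.extend j (by omega) (by omega)), by omega⟩
    · rw [(h.classify (N - 1) (by omega) (by omega)).1] at h1
      exact Or.inr ⟨by omega, rfl⟩
    · rw [(h.classify (N - 1) (by omega) (by omega)).2.1] at h1
      rw [(h.classify N (by omega) (by omega)).2.2] at h2
      exact Or.inl ⟨Or.inr (h.extend N (by omega) (by omega)), by omega⟩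
  constructor
  · intro hne st' hs
    rcases key st' hs with hk | hk
    · exact hk.1
    · exact absurd hk.1 hne
  · intro heq
    refine ⟨⟨Function.update st N PSt.rp, ?_⟩, ?_⟩
    · refine Or.inr (Or.inr (Or.inr (Or.inr (Or.inr (Or.inl ⟨?_, ?_, rfl⟩)))))
      · exact (h.classify (N - 1) (by omega) (by omega)).1.2 (by omega)
      · exact (h.classify N (by omega) (by omega)).2.1.2 (by omega)
    · intro st' hs
      rcases key st' hs with hk | hk
      · exact absurd heq hk.2
      · obtain ⟨-, rfl⟩ := hk
        refine ⟨rfl, by omega, le_refl _, ?_, ?_⟩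
        · intro i h1 h2
          rw [Function.update_of_ne (by omega)]
          exact h.2.2.1 i h1 (by omega)
        · intro i h1 h2
          have : i = N := by omega
          simp [this]
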